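/- For any ordered partition C = [L₁,…,L_K] of V and any subset S ⊆ V, the layered conditional entropy dominates the joint one: Σ_{i=1}^{K+1} H(X_{S∩L_i} Y_{S∩L_{i−1}} | X_{L_i∖S} Y_{L_{i−1}∖S} X_{L^i} Y_{L^{i−1}} Z) ≥ H(X_S Y_S | X_{S^c} Y_{S^c} Z), with equality when S = V. Consequently the essential polytope P_{h_C} of the layered entropy function is contained in the essential polytope P_h of h(S) = H(X_S Y_S | Z). -/

import Mathlib

open Finset in
/-- Probability that the discrete random variable `X` takes the value `a`,
under the weight function `p` on the finite sample space `Ω`. -/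
noncomputable def pr {Ω : Type*} [Fintype Ω] {α : Type*} [DecidableEq α]
    (p : Ω → ℝ) (X : Ω → α) (a : α) : ℝ :=
  ∑ ω ∈ univ.filter (fun ω => X ω = a), p ω

/-- Shannon entropy (base 2) of a discrete random variable. (`0·log 0 = 0` since `logb 2 0 = 0`.) -/
noncomputable def ent {Ω : Type*} [Fintype Ω] {α : Type*} [Fintype α] [DecidableEq α]
    (p : Ω → ℝ) (X : Ω → α) : ℝ :=
  -∑ a : α, pr p X a * Real.logb 2 (pr p X a)

/-- Conditional Shannon entropy `H(X|Z) = H(X,Z) − H(Z)`. -/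
noncomputable def cent {Ω α β : Type*} [Fintype Ω] [Fintype α] [DecidableEq α]
    [Fintype β] [DecidableEq β] (p : Ω → ℝ) (X : Ω → α) (Z : Ω → β) : ℝ :=
  ent p (fun ω => (X ω, Z ω)) - ent p Z

/-- The tuple `X_S = (X_v : v ∈ S)` of a family of random variables, encoded with
`Option`: coordinates outside `S` are masked to `none`. -/
def mask {Ω V : Type*} [DecidableEq V] {α : V → Type*}
    (X : ∀ v, Ω → α v) (S : Finset V) : Ω → ∀ v, Option (α v) :=
  fun ω v => if v ∈ S then some (X v ω) else none

open Finset

/-- Layered conditional entropy term: `H(X_{AX} Y_{AY} | X_{BX} Y_{BY} Z)`, for families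
of discrete random variables `(X_v, Y_v : v ∈ V)` and side information `Z`. -/
noncomputable def ce {Ω V γ : Type*} [Fintype Ω] [Fintype V] [DecidableEq V]
    {α β : V → Type*} [∀ v, Fintype (α v)] [∀ v, DecidableEq (α v)]
    [∀ v, Fintype (β v)] [∀ v, DecidableEq (β v)] [Fintype γ] [DecidableEq γ]
    (p : Ω → ℝ) (X : ∀ v, Ω → α v) (Y : ∀ v, Ω → β v) (Z : Ω → γ)
    (AX AY BX BY : Finset V) : ℝ :=
  cent p (fun ω => (mask X AX ω, mask Y AY ω))
    (fun ω => (mask X BX ω, mask Y BY ω, Z ω))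

/-- `L^i = ∪_{k<i} L_k`, the union of the layers below layer `i`. -/
def lowUnion {V : Type*} [DecidableEq V] (L : ℕ → Finset V) (i : ℕ) : Finset V :=
  (Finset.range i).biUnion L

/-- `[L 1, …, L K]` is an ordered partition of `V` (with conventions `L 0 = ∅` and
`L i = ∅` for `i > K`). -/
def IsOrdPart {V : Type*} [Fintype V] [DecidableEq V] (K : ℕ) (L : ℕ → Finset V) : Prop :=
  (∀ i, 1 ≤ i → i ≤ K → (L i).Nonempty) ∧
  (∀ i, i = 0 ∨ K < i → L i = ∅) ∧
  (∀ i j, i ≠ j → Disjoint (L i) (L j)) ∧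
  (Finset.range (K + 1)).biUnion L = Finset.univ

/-- `h_C(S) = Σ_{i=1}^{K+1} H(X_{S∩L_i} Y_{S∩L_{i−1}} | X_{L^i} Y_{L^{i−1}} Z)`. -/
noncomputable def layerEnt {Ω V γ : Type*} [Fintype Ω] [Fintype V] [DecidableEq V]
    {α β : V → Type*} [∀ v, Fintype (α v)] [∀ v, DecidableEq (α v)]
    [∀ v, Fintype (β v)] [∀ v, DecidableEq (β v)] [Fintype γ] [DecidableEq γ]
    (p : Ω → ℝ) (X : ∀ v, Ω → α v) (Y : ∀ v, Ω → β v) (Z : Ω → γ)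
    (K : ℕ) (L : ℕ → Finset V) (S : Finset V) : ℝ :=
  ∑ i ∈ Finset.Icc 1 (K + 1),
    ce p X Y Z (S ∩ L i) (S ∩ L (i - 1)) (lowUnion L i) (lowUnion L (i - 1))

/-- `h_C(S|Sᶜ)`-style layered sum:
`Σ_{i=1}^{K+1} H(X_{S∩L_i} Y_{S∩L_{i−1}} | X_{L_i∖S} Y_{L_{i−1}∖S} X_{L^i} Y_{L^{i−1}} Z)`. -/
noncomputable def layerCondEnt {Ω V γ : Type*} [Fintype Ω] [Fintype V] [DecidableEq V]
    {α β : V → Type*} [∀ v, Fintype (α v)] [∀ v, DecidableEq (α v)]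
    [∀ v, Fintype (β v)] [∀ v, DecidableEq (β v)] [Fintype γ] [DecidableEq γ]
    (p : Ω → ℝ) (X : ∀ v, Ω → α v) (Y : ∀ v, Ω → β v) (Z : Ω → γ)
    (K : ℕ) (L : ℕ → Finset V) (S : Finset V) : ℝ :=
  ∑ i ∈ Finset.Icc 1 (K + 1),
    ce p X Y Z (S ∩ L i) (S ∩ L (i - 1))
      ((L i \ S) ∪ lowUnion L i) ((L (i - 1) \ S) ∪ lowUnion L (i - 1))

/-- The essential polytope of a set function `f` on `V`. -/
def essPoly {V : Type*} [Fintype V] [DecidableEq V] (f : Finset V → ℝ) :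
    Set (V → ℝ) :=
  {x | (∑ v, x v = f Finset.univ) ∧
    ∀ S : Finset V, f Finset.univ - f Sᶜ ≤ ∑ v ∈ S, x v}

section Entropy

variable {Ω : Type*} [Fintype Ω]

theorem pr_nonneg {α : Type*} [DecidableEq α] {p : Ω → ℝ} (hp : ∀ ω, 0 ≤ p ω) (X : Ω → α)
    (a : α) : 0 ≤ pr p X a :=
  Finset.sum_nonneg fun ω _ => hp ω

theorem pr_self_pos {α : Type*} [DecidableEq α] {p : Ω → ℝ} (hp : ∀ ω, 0 ≤ p ω) (X : Ω → α)
    {ω : Ω} (hω : 0 < p ω) : 0 < pr p X (X ω) :=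
  hω.trans_le (Finset.single_le_sum (fun ω _ => hp ω) (by simp))

theorem sum_pr_prodMk {α δ : Type*} [Fintype α] [DecidableEq α] [DecidableEq δ] (p : Ω → ℝ)
    (A : Ω → α) (C : Ω → δ) (c : δ) :
    ∑ a, pr p (fun ω => (A ω, C ω)) (a, c) = pr p C c := by
  simp only [pr, Prod.mk.injEq]
  rw [← Finset.sum_fiberwise (Finset.univ.filter fun ω => C ω = c) A]
  refine Finset.sum_congr rfl fun a _ => ?_
  rw [Finset.filter_filter]
  simp only [and_comm]

variable {α β δ : Type*} [Fintype α] [DecidableEq α] [Fintype β] [DecidableEq β]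
  [Fintype δ] [DecidableEq δ] (p : Ω → ℝ)

theorem sum_mul_comp_eq_sum_pr (X : Ω → α) (g : α → ℝ) :
    ∑ ω, p ω * g (X ω) = ∑ a, pr p X a * g a := by
  rw [← Finset.sum_fiberwise Finset.univ X]
  refine Finset.sum_congr rfl fun a _ => ?_
  rw [pr, Finset.sum_mul]
  refine Finset.sum_congr rfl fun ω hω => ?_
  rw [(Finset.mem_filter.mp hω).2]

theorem sum_pr (X : Ω → α) : ∑ a, pr p X a = ∑ ω, p ω := by
  simpa using (sum_mul_comp_eq_sum_pr p X fun _ => 1).symm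

theorem ent_eq_sum (X : Ω → α) :
    ent p X = -∑ ω, p ω * Real.logb 2 (pr p X (X ω)) := by
  rw [ent, sum_mul_comp_eq_sum_pr p X fun a => Real.logb 2 (pr p X a)]

/-- Entropy depends only on the partition of the sample space induced by the variable. -/
theorem ent_congr {α β : Type*} {_ : Fintype α} {_ : DecidableEq α} {_ : Fintype β}
    {_ : DecidableEq β} {X : Ω → α} {Y : Ω → β} (h : ∀ ω ω', X ω = X ω' ↔ Y ω = Y ω') :
    ent p X = ent p Y := by
  simp only [ent_eq_sum, pr, h]

variable {p} in
/-- Strong subadditivity: `H(A,B,C) + H(C) ≤ H(A,C) + H(B,C)`. -/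
theorem ent_strong_subadditive (hp : ∀ ω, 0 ≤ p ω) (A : Ω → α) (B : Ω → β) (C : Ω → δ) :
    ent p (fun ω => (A ω, B ω, C ω)) + ent p C ≤
      ent p (fun ω => (A ω, C ω)) + ent p (fun ω => (B ω, C ω)) := by
  set P := pr p (fun ω => (A ω, B ω, C ω)) with hP
  set Q := pr p (fun ω => (A ω, C ω)) with hQ
  set R := pr p (fun ω => (B ω, C ω)) with hR
  set T := pr p C with hT
  let r : α × β × δ → ℝ := fun x => Q (x.1, x.2.2) * R x.2 / (P x * T x.2.2)
  have hr : ∑ ω, p ω * r (A ω, B ω, C ω) ≤ ∑ ω, p ω := by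
    rw [sum_mul_comp_eq_sum_pr p (fun ω => (A ω, B ω, C ω)) r]
    calc ∑ x, P x * r x
        ≤ ∑ x : α × β × δ, Q (x.1, x.2.2) * R x.2 / T x.2.2 := by
          refine Finset.sum_le_sum fun x _ => ?_
          have h0 : 0 ≤ Q (x.1, x.2.2) * R x.2 / T x.2.2 :=
            div_nonneg (mul_nonneg (pr_nonneg hp _ _) (pr_nonneg hp _ _)) (pr_nonneg hp _ _)
          by_cases hx : P x = 0
          · simpa [hx] using h0
          · refine le_of_eq ?_
            change P x * (Q (x.1, x.2.2) * R x.2 / (P x * T x.2.2)) = _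
            rw [← mul_div_assoc, mul_div_mul_left _ _ hx]
      _ = ∑ c, (∑ a, Q (a, c)) * (∑ b, R (b, c)) / T c := by
          simp only [Fintype.sum_prod_type, Finset.sum_mul_sum, Finset.sum_div]
          rw [Finset.sum_comm' (t' := Finset.univ) (s' := fun _ => Finset.univ) (by simp),
            Finset.sum_comm]
          simp_rw [Finset.sum_comm (s := (Finset.univ : Finset α))]
          rw [Finset.sum_comm]
      _ = ∑ c, T c := by
          refine Finset.sum_congr rfl fun c _ => ?_
          rw [hQ, hR, sum_pr_prodMk, sum_pr_prodMk, mul_self_div_self]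
      _ = ∑ ω, p ω := sum_pr p C
  have key : ∑ ω, p ω * (Real.log (Q (A ω, C ω)) + Real.log (R (B ω, C ω))
      - Real.log (P (A ω, B ω, C ω)) - Real.log (T (C ω))) ≤ 0 := by
    calc _ ≤ ∑ ω, (p ω * r (A ω, B ω, C ω) - p ω) := by
          refine Finset.sum_le_sum fun ω _ => ?_
          rcases (hp ω).eq_or_lt with h | h
          · simp [← h]
          have hQ' : 0 < Q (A ω, C ω) := pr_self_pos hp (fun ω => (A ω, C ω)) h
          have hR' : 0 < R (B ω, C ω) := pr_self_pos hp (fun ω => (B ω, C ω)) h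
          have hP' : 0 < P (A ω, B ω, C ω) := pr_self_pos hp (fun ω => (A ω, B ω, C ω)) h
          have hT' : 0 < T (C ω) := pr_self_pos hp C h
          have hlog := Real.log_le_sub_one_of_pos (div_pos (mul_pos hQ' hR') (mul_pos hP' hT'))
          rw [Real.log_div (mul_pos hQ' hR').ne' (mul_pos hP' hT').ne',
            Real.log_mul hQ'.ne' hR'.ne', Real.log_mul hP'.ne' hT'.ne'] at hlog
          have := mul_le_mul_of_nonneg_left hlog h.le
          simp only [r]
          linarith
      _ ≤ 0 := by rw [Finset.sum_sub_distrib]; linarith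
  have hlog2 : 0 < Real.log 2 := Real.log_pos one_lt_two
  have key' := div_nonpos_of_nonpos_of_nonneg key hlog2.le
  simp only [ent_eq_sum, ← hP, ← hQ, ← hR, ← hT]
  have expand : (∑ ω, p ω * (Real.log (Q (A ω, C ω)) + Real.log (R (B ω, C ω))
      - Real.log (P (A ω, B ω, C ω)) - Real.log (T (C ω)))) / Real.log 2
      = ∑ ω, p ω * Real.logb 2 (Q (A ω, C ω)) + ∑ ω, p ω * Real.logb 2 (R (B ω, C ω))
        - ∑ ω, p ω * Real.logb 2 (P (A ω, B ω, C ω)) - ∑ ω, p ω * Real.logb 2 (T (C ω)) := by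
    rw [← Finset.sum_add_distrib, ← Finset.sum_sub_distrib, ← Finset.sum_sub_distrib,
      Finset.sum_div]
    refine Finset.sum_congr rfl fun ω _ => ?_
    simp only [Real.logb]
    ring
  linarith

end Entropy

theorem mask_eq_mask_iff {Ω V : Type*} [DecidableEq V] {α : V → Type*} (X : ∀ v, Ω → α v)
    (S : Finset V) (ω ω' : Ω) : mask X S ω = mask X S ω' ↔ ∀ v ∈ S, X v ω = X v ω' := by
  simp only [mask, funext_iff]
  refine forall_congr' fun v => ?_
  by_cases hv : v ∈ S <;> simp [hv]

theorem lowUnion_succ {V : Type*} [DecidableEq V] (L : ℕ → Finset V) (i : ℕ) :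
    lowUnion L (i + 1) = L i ∪ lowUnion L i := by
  simp [lowUnion, Finset.range_add_one, Finset.biUnion_insert]

theorem lowUnion_one {V : Type*} [DecidableEq V] {L : ℕ → Finset V} (h : L 0 = ∅) :
    lowUnion L 1 = ∅ := by
  simp [lowUnion, h]

theorem sum_Icc_one_eq_sum_range (f : ℕ → ℝ) (n : ℕ) :
    ∑ i ∈ Finset.Icc 1 n, f i = ∑ i ∈ Finset.range n, f (i + 1) := by
  rw [Finset.range_eq_Ico, Finset.sum_Ico_add' f 0 n 1]
  rfl

section Joint

variable {Ω V γ : Type*} [Fintype Ω] [Fintype V] [DecidableEq V]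
  {α β : V → Type*} [∀ v, Fintype (α v)] [∀ v, DecidableEq (α v)]
  [∀ v, Fintype (β v)] [∀ v, DecidableEq (β v)] [Fintype γ] [DecidableEq γ]
  (p : Ω → ℝ) (X : ∀ v, Ω → α v) (Y : ∀ v, Ω → β v) (Z : Ω → γ)

/-- The joint entropy `H(X_A Y_B Z)`. -/
noncomputable def jointEnt (A B : Finset V) : ℝ :=
  ent p (fun ω => (mask X A ω, mask Y B ω, Z ω))

theorem ce_eq_jointEnt_sub (AX AY BX BY : Finset V) :
    ce p X Y Z AX AY BX BY =
      jointEnt p X Y Z (AX ∪ BX) (AY ∪ BY) - jointEnt p X Y Z BX BY := by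
  rw [ce, cent, jointEnt, jointEnt]
  congr 1
  refine ent_congr p fun ω ω' => ?_
  simp only [Prod.mk.injEq, mask_eq_mask_iff, Finset.forall_mem_union]
  tauto

variable {p} in
theorem jointEnt_submodular (hp : ∀ ω, 0 ≤ p ω) (A B C D : Finset V) :
    jointEnt p X Y Z (A ∪ C) (B ∪ D) + jointEnt p X Y Z (A ∩ C) (B ∩ D) ≤
      jointEnt p X Y Z A B + jointEnt p X Y Z C D := by
  have h := ent_strong_subadditive hp (fun ω => (mask X A ω, mask Y B ω))
    (fun ω => (mask X C ω, mask Y D ω))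
    (fun ω => (mask X (A ∩ C) ω, mask Y (B ∩ D) ω, Z ω))
  simp only [jointEnt]
  convert h using 2 <;> refine ent_congr p fun ω ω' => ?_ <;>
    simp only [Prod.mk.injEq, mask_eq_mask_iff, Finset.forall_mem_union, Finset.mem_inter] <;>
    grind

/-- Chain rule: the layered conditional entropy as a sum of differences of joint entropies. -/
theorem layerCondEnt_eq_sum (K : ℕ) (L : ℕ → Finset V) (S : Finset V) :
    layerCondEnt p X Y Z K L S = ∑ i ∈ Finset.range (K + 1),
      (jointEnt p X Y Z (lowUnion L (i + 2)) (lowUnion L (i + 1)) -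
        jointEnt p X Y Z ((L (i + 1) \ S) ∪ lowUnion L (i + 1)) ((L i \ S) ∪ lowUnion L i)) := by
  rw [layerCondEnt, sum_Icc_one_eq_sum_range]
  refine Finset.sum_congr rfl fun i _ => ?_
  rw [ce_eq_jointEnt_sub, lowUnion_succ L (i + 1)]
  simp only [Nat.add_sub_cancel]
  rw [lowUnion_succ L i]
  congr 2 <;> grind

theorem layerEnt_univ_sub_compl (K : ℕ) (L : ℕ → Finset V) (S : Finset V) :
    layerEnt p X Y Z K L Finset.univ - layerEnt p X Y Z K L Sᶜ = layerCondEnt p X Y Z K L S := by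
  simp only [layerEnt, layerCondEnt, ← Finset.sum_sub_distrib]
  refine Finset.sum_congr rfl fun i _ => ?_
  simp only [ce_eq_jointEnt_sub, sub_sub_sub_cancel_right, Finset.univ_inter,
    Finset.inter_comm Sᶜ, ← Finset.sdiff_eq_inter_compl]
  congr 2 <;> grind

theorem layerCondEnt_univ {K : ℕ} {L : ℕ → Finset V} (hC : IsOrdPart K L) :
    layerCondEnt p X Y Z K L Finset.univ = ce p X Y Z Finset.univ Finset.univ ∅ ∅ := by
  obtain ⟨-, hL, -, hV⟩ := hC
  have hV' : lowUnion L (K + 1) = Finset.univ := hV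
  have hV2 : lowUnion L (K + 2) = Finset.univ := by rw [lowUnion_succ, hV']; simp
  rw [layerCondEnt_eq_sum, ce_eq_jointEnt_sub]
  have hsdiff (T : Finset V) : T \ Finset.univ = ∅ := by simp
  simp only [hsdiff, Finset.empty_union, Finset.union_empty]
  rw [Finset.sum_range_sub (fun i => jointEnt p X Y Z (lowUnion L (i + 1)) (lowUnion L i)),
    hV2, hV', lowUnion_one (hL 0 (.inl rfl))]
  rfl

variable {p} in
theorem ce_compl_le_layerCondEnt (hp : ∀ ω, 0 ≤ p ω) {K : ℕ} {L : ℕ → Finset V}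
    (hC : IsOrdPart K L) (S : Finset V) :
    ce p X Y Z S S Sᶜ Sᶜ ≤ layerCondEnt p X Y Z K L S := by
  obtain ⟨-, hL, -, hV⟩ := hC
  have hV' : lowUnion L (K + 1) = Finset.univ := hV
  have hV2 : lowUnion L (K + 2) = Finset.univ := by rw [lowUnion_succ, hV']; simp
  let g : ℕ → ℝ := fun i => jointEnt p X Y Z (lowUnion L (i + 1)) (lowUnion L i) -
    jointEnt p X Y Z (lowUnion L (i + 1) \ S) (lowUnion L i \ S)
  have hg0 : g 0 = 0 := by
    have h0 : lowUnion L 0 = ∅ := rfl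
    simp [g, lowUnion_one (hL 0 (.inl rfl)), h0]
  have hgK : g (K + 1) = ce p X Y Z S S Sᶜ Sᶜ := by
    simp [g, hV', hV2, ce_eq_jointEnt_sub, ← Finset.compl_eq_univ_sdiff]
  rw [layerCondEnt_eq_sum, ← hgK, ← sub_zero (g (K + 1)), ← hg0, ← Finset.sum_range_sub g]
  refine Finset.sum_le_sum fun i _ => ?_
  have h := jointEnt_submodular X Y Z hp (lowUnion L (i + 1)) (lowUnion L i)
    (lowUnion L (i + 2) \ S) (lowUnion L (i + 1) \ S)
  have h1 : lowUnion L (i + 1) ∪ lowUnion L (i + 2) \ S =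
      (L (i + 1) \ S) ∪ lowUnion L (i + 1) := by
    rw [lowUnion_succ L (i + 1)]; grind
  have h2 : lowUnion L i ∪ lowUnion L (i + 1) \ S = (L i \ S) ∪ lowUnion L i := by
    rw [lowUnion_succ L i]; grind
  have h3 : lowUnion L (i + 1) ∩ (lowUnion L (i + 2) \ S) = lowUnion L (i + 1) \ S := by
    rw [lowUnion_succ L (i + 1)]; grind
  have h4 : lowUnion L i ∩ (lowUnion L (i + 1) \ S) = lowUnion L i \ S := by
    rw [lowUnion_succ L i]; grind
  rw [h1, h2, h3, h4] at h
  simp only [g]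
  linarith

end Joint

/-- For any ordered partition `C = [L₁,…,L_K]` of `V` the layered conditional entropy
dominates the joint one, with equality at `S = V`; consequently `P_{h_C} ⊆ P_h` where
`h(S) = H(X_S Y_S | Z)` and `h_C` is the layered entropy function. -/
theorem layered_dominates_joint {Ω V γ : Type*} [Fintype Ω] [Fintype V] [DecidableEq V]
    {α β : V → Type*} [∀ v, Fintype (α v)] [∀ v, DecidableEq (α v)]
    [∀ v, Fintype (β v)] [∀ v, DecidableEq (β v)] [Fintype γ] [DecidableEq γ]
    (p : Ω → ℝ) (hp0 : ∀ ω, 0 ≤ p ω) (hp1 : ∑ ω, p ω = 1)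
    (X : ∀ v, Ω → α v) (Y : ∀ v, Ω → β v) (Z : Ω → γ)
    (K : ℕ) (L : ℕ → Finset V) (hC : IsOrdPart K L) :
    (∀ S : Finset V,
      ce p X Y Z S S Sᶜ Sᶜ ≤ layerCondEnt p X Y Z K L S) ∧
    (layerCondEnt p X Y Z K L Finset.univ = ce p X Y Z Finset.univ Finset.univ ∅ ∅) ∧
    essPoly (layerEnt p X Y Z K L) ⊆ essPoly (fun S => ce p X Y Z S S ∅ ∅) := by
  have hle := fun S => ce_compl_le_layerCondEnt X Y Z hp0 hC S
  have huniv := layerCondEnt_univ p X Y Z hC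
  refine ⟨hle, huniv, ?_⟩
  rintro x ⟨hsum, hx⟩
  have hempty : layerEnt p X Y Z K L ∅ = 0 := by simp [layerEnt, ce_eq_jointEnt_sub]
  refine ⟨?_, fun S => ?_⟩
  · have h := layerEnt_univ_sub_compl p X Y Z K L Finset.univ
    rw [Finset.compl_univ, hempty, sub_zero, huniv] at h
    exact hsum.trans h
  · refine le_trans (le_of_eq_of_le ?_ (hle S))
      ((layerEnt_univ_sub_compl p X Y Z K L S).ge.trans (hx S))
    simp [ce_eq_jointEnt_sub]
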